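/- arXiv:2111.13848 — 9 statements merged into one kernel-verified Lean document; each statement's English description precedes it below -/
import Mathlib

section
/- Let α > 0, let δ : ℝ → ℝ be continuous, let Θ* be a fixed real q×n matrix, and set 𝒴(t) = δ(t)·Θ*. If Θ : ℝ → Matrix(q,n,ℝ) satisfies the gradient update law Θ'(t) = α·δ(t)·(𝒴(t) − δ(t)·Θ(t)) for all t ≥ 0 (derivative in the Frobenius-norm matrix space), then for every t ≥ 0 the estimation error satisfies Θ(t) − Θ* = exp(−α·∫₀ᵗ δ(τ)² dτ)·(Θ(0) − Θ*). -/
attribute [local instance] Matrix.frobeniusNormedAddCommGroup Matrix.frobeniusNormedSpace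

theorem drem_aux {E : Type*} [NormedAddCommGroup E] [NormedSpace ℝ E]
    (α : ℝ) (δ : ℝ → ℝ) (hδ : Continuous δ) (S : E) (Θ : ℝ → E)
    (h : ∀ t ≥ (0 : ℝ), HasDerivAt Θ ((α * δ t) • (δ t • S - δ t • Θ t)) t)
    (t : ℝ) (ht : 0 ≤ t) :
    Θ t - S = Real.exp (-α * ∫ τ in (0 : ℝ)..t, (δ τ) ^ 2) • (Θ 0 - S) := by
  have hI : ∀ s, HasDerivAt (fun u => ∫ τ in (0 : ℝ)..u, (δ τ) ^ 2) (δ s ^ 2) s := fun s =>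
    (hδ.pow 2).integral_hasStrictDerivAt 0 s |>.hasDerivAt
  have hg : ∀ s ≥ (0 : ℝ), HasDerivAt
      (fun u => Real.exp (α * ∫ τ in (0 : ℝ)..u, (δ τ) ^ 2) • (Θ u - S)) 0 s := by
    intro s hs
    have h1 := (((hI s).const_mul α).exp).smul ((h s hs).sub_const S)
    refine h1.congr_deriv ?_
    module
  have hc := constant_of_has_deriv_right_zero (a := 0) (b := t)
    (fun s hs => (hg s hs.1).continuousAt.continuousWithinAt)
    (fun s hs => (hg s hs.1).hasDerivWithinAt) t ⟨ht, le_rfl⟩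
  simp only [intervalIntegral.integral_same, mul_zero, Real.exp_zero, one_smul] at hc
  rw [← hc, smul_smul, ← Real.exp_add]
  simp

/-- DREM gradient estimator: explicit solution of the estimation-error dynamics.
If `Θ' t = α • δ t • (𝒴 t - δ t • Θ t)` with `𝒴 t = δ t • Θ*`, then
`Θ t - Θ* = exp (-α ∫₀ᵗ δ² ) • (Θ 0 - Θ*)` for all `t ≥ 0`. -/
theorem drem_error_explicit {q n : ℕ}
    (α : ℝ) (hα : 0 < α)
    (δ : ℝ → ℝ) (hδ : Continuous δ)
    (Θstar : Matrix (Fin q) (Fin n) ℝ)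
    (𝒴 : ℝ → Matrix (Fin q) (Fin n) ℝ)
    (h𝒴 : ∀ t, 𝒴 t = δ t • Θstar)
    (Θ : ℝ → Matrix (Fin q) (Fin n) ℝ)
    (hupd : ∀ t ≥ (0 : ℝ), HasDerivAt Θ ((α * δ t) • (𝒴 t - δ t • Θ t)) t) :
    ∀ t ≥ (0 : ℝ),
      Θ t - Θstar =
        Real.exp (-α * ∫ τ in (0 : ℝ)..t, (δ τ) ^ 2) • (Θ 0 - Θstar) := by
  intro t ht
  refine drem_aux α δ hδ Θstar Θ (fun s hs => ?_) t ht
  rw [← h𝒴 s]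
  exact hupd s hs
end

section
/- Let α > 0, let δ : ℝ → ℝ be continuous, let Θ* be a fixed real q×n matrix, and suppose Θ : ℝ → Matrix(q,n,ℝ) satisfies Θ'(t) = α·δ(t)·(δ(t)·Θ* − δ(t)·Θ(t)) for all t ≥ 0. Then for all 0 ≤ t₂ ≤ t₁ and all indices i, j, one has |Θ(t₁)ᵢⱼ − Θ*ᵢⱼ| ≤ |Θ(t₂)ᵢⱼ − Θ*ᵢⱼ|; in particular the Frobenius norm ‖Θ(t) − Θ*‖ is non-increasing in t. -/
attribute [local instance] Matrix.frobeniusNormedAddCommGroup Matrix.frobeniusNormedSpace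

/-- Under the DREM gradient update law, each element-wise estimation error is
monotonically non-increasing in absolute value, and so is the Frobenius norm
of the estimation error. -/
theorem drem_error_monotone {q n : ℕ}
    (α : ℝ) (hα : 0 < α)
    (δ : ℝ → ℝ) (hδ : Continuous δ)
    (Θstar : Matrix (Fin q) (Fin n) ℝ)
    (Θ : ℝ → Matrix (Fin q) (Fin n) ℝ)
    (hupd : ∀ t ≥ (0 : ℝ), HasDerivAt Θ ((α * δ t) • (δ t • Θstar - δ t • Θ t)) t) :
    ∀ t₂ t₁ : ℝ, 0 ≤ t₂ → t₂ ≤ t₁ →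
      (∀ i j, |(Θ t₁ - Θstar) i j| ≤ |(Θ t₂ - Θstar) i j|) ∧
      ‖Θ t₁ - Θstar‖ ≤ ‖Θ t₂ - Θstar‖ := by
  have hentry : ∀ i j, ∀ t ≥ (0 : ℝ), HasDerivAt (fun s => (Θ s - Θstar) i j)
      (-(α * δ t ^ 2) * (Θ t - Θstar) i j) t := by
    intro i j t ht
    have h := ((LinearMap.toContinuousLinearMap
      (Matrix.entryLinearMap ℝ ℝ i j : Matrix (Fin q) (Fin n) ℝ →ₗ[ℝ] ℝ)).hasFDerivAt).comp_hasDerivAt t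
        ((hupd t ht).sub_const Θstar)
    refine h.congr_deriv ?_
    change (α * δ t) * (δ t * Θstar i j - δ t * Θ t i j) =
      -(α * δ t ^ 2) * (Θ t i j - Θstar i j)
    ring
  intro t₂ t₁ h0 h21
  have key : ∀ i j, |(Θ t₁ - Θstar) i j| ≤ |(Θ t₂ - Θstar) i j| := by
    intro i j
    have hsq : ∀ t ≥ (0 : ℝ), HasDerivAt (fun s => ((Θ s - Θstar) i j) ^ 2)
        (-(2 * α * δ t ^ 2 * ((Θ t - Θstar) i j) ^ 2)) t := by
      intro t ht
      refine ((hentry i j t ht).pow 2).congr_deriv ?_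
      push_cast
      ring
    have hanti : AntitoneOn (fun s => ((Θ s - Θstar) i j) ^ 2) (Set.Ici 0) := by
      refine antitoneOn_of_hasDerivWithinAt_nonpos (convex_Ici 0)
        (fun t ht => (hsq t ht).continuousAt.continuousWithinAt)
        (fun t ht => (hsq t (interior_subset ht)).hasDerivWithinAt) ?_
      intro t _
      have : 0 ≤ 2 * α * δ t ^ 2 * ((Θ t - Θstar) i j) ^ 2 := by positivity
      linarith
    exact sq_le_sq.mp (hanti h0 (h0.trans h21) h21)
  refine ⟨key, ?_⟩
  rw [Matrix.frobenius_norm_def, Matrix.frobenius_norm_def]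
  simp only [Real.norm_eq_abs]
  refine Real.rpow_le_rpow (by positivity) ?_ (by norm_num)
  refine Finset.sum_le_sum fun i _ => Finset.sum_le_sum fun j _ => ?_
  exact Real.rpow_le_rpow (abs_nonneg _) (key i j) (by norm_num)
end

section
/- Let α > 0, let δ : ℝ → ℝ be continuous, let Θ* be a fixed real q×n matrix, and suppose Θ : ℝ → Matrix(q,n,ℝ) satisfies Θ'(t) = α·δ(t)·(δ(t)·Θ* − δ(t)·Θ(t)) for all t ≥ 0. If δ ∉ L², i.e. ∫₀ᵗ δ(τ)² dτ → ∞ as t → ∞, then Θ(t) → Θ* as t → ∞ (in Frobenius norm). -/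
attribute [local instance] Matrix.frobeniusNormedAddCommGroup Matrix.frobeniusNormedSpace

theorem drem_aux_s2 {E : Type*} [NormedAddCommGroup E] [NormedSpace ℝ E]
    (α : ℝ) (hα : 0 < α) (δ : ℝ → ℝ) (hδ : Continuous δ) (s : E) (x : ℝ → E)
    (hupd : ∀ t ≥ (0 : ℝ), HasDerivAt x ((α * δ t) • (δ t • s - δ t • x t)) t)
    (hL2 : Filter.Tendsto (fun t => ∫ τ in (0 : ℝ)..t, (δ τ) ^ 2)
      Filter.atTop Filter.atTop) :
    Filter.Tendsto x Filter.atTop (nhds s) := by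
  set F : ℝ → ℝ := fun t => ∫ τ in (0 : ℝ)..t, (δ τ) ^ 2 with hF
  have hFd : ∀ t, HasDerivAt F (δ t ^ 2) t := fun t =>
    (hδ.pow 2).integral_hasStrictDerivAt 0 t |>.hasDerivAt
  have hg : ∀ t ≥ (0 : ℝ), HasDerivAt (fun t => Real.exp (α * F t) • (x t - s)) 0 t := by
    intro t ht
    have h := (((hFd t).const_mul α).exp).smul ((hupd t ht).sub_const s)
    refine h.congr_deriv ?_
    module
  have hconst : ∀ t ≥ (0 : ℝ), Real.exp (α * F t) • (x t - s) = x 0 - s := by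
    intro t ht
    have h := constant_of_has_deriv_right_zero
      (f := fun t => Real.exp (α * F t) • (x t - s)) (a := 0) (b := t)
      (fun y hy => (hg y hy.1).continuousAt.continuousWithinAt)
      (fun y hy => (hg y hy.1).hasDerivWithinAt) t ⟨ht, le_rfl⟩
    simpa [hF] using h
  have hsol : ∀ t ≥ (0 : ℝ), x t = Real.exp (-(α * F t)) • (x 0 - s) + s := by
    intro t ht
    rw [← hconst t ht, smul_smul, ← Real.exp_add]
    simp
  have hexp : Filter.Tendsto (fun t => Real.exp (-(α * F t))) Filter.atTop (nhds 0) :=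
    Real.tendsto_exp_neg_atTop_nhds_zero.comp (hL2.const_mul_atTop hα)
  have hlim : Filter.Tendsto (fun t => Real.exp (-(α * F t)) • (x 0 - s) + s)
      Filter.atTop (nhds s) := by
    simpa using (hexp.smul_const (x 0 - s)).add_const s
  refine hlim.congr' ?_
  filter_upwards [Filter.eventually_ge_atTop (0 : ℝ)] with t ht
  exact (hsol t ht).symm

/-- DREM gradient estimator: if `δ ∉ L²`, i.e. `∫₀ᵗ δ² → ∞`, then the estimate
`Θ t` converges (in Frobenius norm) to the true parameter matrix `Θ*`. -/
theorem drem_convergence_not_L2 {q n : ℕ}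
    (α : ℝ) (hα : 0 < α)
    (δ : ℝ → ℝ) (hδ : Continuous δ)
    (Θstar : Matrix (Fin q) (Fin n) ℝ)
    (Θ : ℝ → Matrix (Fin q) (Fin n) ℝ)
    (hupd : ∀ t ≥ (0 : ℝ), HasDerivAt Θ ((α * δ t) • (δ t • Θstar - δ t • Θ t)) t)
    (hL2 : Filter.Tendsto (fun t => ∫ τ in (0 : ℝ)..t, (δ τ) ^ 2)
      Filter.atTop Filter.atTop) :
    Filter.Tendsto Θ Filter.atTop (nhds Θstar) := by
  exact drem_aux_s2 α hα δ hδ Θstar Θ hupd hL2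
end

section
/- Let λ > 0 and let v : ℝ → ℝⁿ be differentiable with continuous derivative v'. Suppose y : ℝ → ℝⁿ and v_l : ℝ → ℝⁿ satisfy the filter equations y'(t) = −λ·y(t) + v'(t) with y(0) = 0, and v_l'(t) = −λ·v_l(t) + v(t) with v_l(0) = 0, for all t ≥ 0. Then for every t ≥ 0, y(t) = v(t) − e^{−λt}·v(0) − λ·v_l(t). -/
/-- The filtered derivative `y` (output of the filter `1/(p+λ)` applied to `v'`)
can be expressed in measurable quantities: `y t = v t - e^{-λ t} • v 0 - λ • v_l t`,
where `v_l` is the filtered state. -/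
theorem filtered_derivative_identity {n : ℕ}
    (lam : ℝ) (hlam : 0 < lam)
    (v v' : ℝ → EuclideanSpace ℝ (Fin n))
    (hv : ∀ t, HasDerivAt v (v' t) t)
    (hv' : Continuous v')
    (y vl : ℝ → EuclideanSpace ℝ (Fin n))
    (hy0 : y 0 = 0) (hvl0 : vl 0 = 0)
    (hy : ∀ t ≥ (0 : ℝ), HasDerivAt y (-lam • y t + v' t) t)
    (hvl : ∀ t ≥ (0 : ℝ), HasDerivAt vl (-lam • vl t + v t) t) :
    ∀ t ≥ (0 : ℝ), y t = v t - Real.exp (-lam * t) • v 0 - lam • vl t := by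
  intro t ht
  have hg : ∀ s ≥ (0 : ℝ),
      HasDerivAt (fun s => Real.exp (lam * s) • (y s - v s + lam • vl s)) 0 s := by
    intro s hs
    have he : HasDerivAt (fun s => Real.exp (lam * s)) (Real.exp (lam * s) * lam) s := by
      simpa using ((hasDerivAt_id s).const_mul lam).exp
    have h := he.smul (((hy s hs).sub (hv s)).add ((hvl s hs).const_smul lam))
    refine h.congr_deriv ?_
    simp only [Pi.add_apply, Pi.sub_apply, Pi.smul_apply]
    module
  have hc := constant_of_has_deriv_right_zero (a := 0) (b := t)
    (fun s hs => (hg s hs.1).continuousAt.continuousWithinAt)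
    (fun s hs => (hg s hs.1).hasDerivWithinAt) t ⟨ht, le_refl t⟩
  simp only [hy0, hvl0, mul_zero, Real.exp_zero, one_smul, smul_zero, add_zero, zero_sub] at hc
  have h1 : Real.exp (-lam * t) * Real.exp (lam * t) = 1 := by
    rw [← Real.exp_add]; simp
  have h2 : y t - v t + lam • vl t = -(Real.exp (-lam * t) • v 0) := by
    rw [← smul_neg, ← hc, smul_smul, h1, one_smul]
  have h3 : y t = (y t - v t + lam • vl t) + v t - lam • vl t := by abel
  rw [h3, h2]
  abel
end

section
/- Let E be a complete real inner product space, f : E → ℝ a differentiable function with gradient ∇f, f* ∈ ℝ with f(y) ≥ f* for all y ∈ E, and μ > 0. Suppose x : ℝ → E satisfies the gradient flow x'(t) = −∇f(x(t)) for all t ≥ t₀, and that the Polyak–Łojasiewicz inequality ‖∇f(y)‖² ≥ 2μ·(f(y) − f*) holds for every y in the sublevel set {y : f(y) ≤ f(x(t₀))}. Then for all t ≥ t₀, f(x(t)) − f* ≤ (f(x(t₀)) − f*)·e^{−2μ(t−t₀)}. -/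
/-- Gradient flow under the Polyak–Łojasiewicz inequality: the value gap
decays exponentially, `f (x t) - f* ≤ (f (x t₀) - f*) e^{-2μ (t - t₀)}`. -/
theorem gradient_flow_PL_exponential_decay
    {E : Type*} [NormedAddCommGroup E] [InnerProductSpace ℝ E] [CompleteSpace E]
    (f : E → ℝ) (f' : E → E) (hf : ∀ y, HasGradientAt f (f' y) y)
    (fstar : ℝ) (hbound : ∀ y, fstar ≤ f y)
    (μ : ℝ) (hμ : 0 < μ)
    (t₀ : ℝ) (x : ℝ → E)
    (hflow : ∀ t ≥ t₀, HasDerivAt x (-f' (x t)) t)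
    (hPL : ∀ y, f y ≤ f (x t₀) → ‖f' y‖ ^ 2 ≥ 2 * μ * (f y - fstar)) :
    ∀ t ≥ t₀, f (x t) - fstar ≤ (f (x t₀) - fstar) * Real.exp (-2 * μ * (t - t₀)) := by
  have hanti : ∀ (h h' : ℝ → ℝ), (∀ t ≥ t₀, HasDerivAt h (h' t) t) →
      (∀ t ≥ t₀, h' t ≤ 0) → ∀ t ≥ t₀, h t ≤ h t₀ := by
    intro h h' hd hn t ht
    have H : AntitoneOn h (Set.Ici t₀) := by
      refine antitoneOn_of_deriv_nonpos (convex_Ici t₀)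
        (fun s hs => (hd s hs).continuousAt.continuousWithinAt) ?_ ?_
      · intro s hs
        exact (hd s (interior_subset hs)).differentiableAt.differentiableWithinAt
      · intro s hs
        rw [(hd s (interior_subset hs)).deriv]
        exact hn s (interior_subset hs)
    exact H (Set.mem_Ici.2 le_rfl) (Set.mem_Ici.2 ht) ht
  have hd : ∀ t ≥ t₀, HasDerivAt (fun t => f (x t)) (-‖f' (x t)‖ ^ 2) t := by
    intro t ht
    have h := (hf (x t)).hasFDerivAt.comp_hasDerivAt t (hflow t ht)
    simpa [Function.comp_def, inner_neg_right, real_inner_self_eq_norm_sq] using h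
  have hle := hanti _ _ hd (fun t _ => neg_nonpos.2 (sq_nonneg _))
  have hd2 : ∀ t ≥ t₀, HasDerivAt
      (fun t => (f (x t) - fstar) * Real.exp (2 * μ * (t - t₀)))
      ((-‖f' (x t)‖ ^ 2) * Real.exp (2 * μ * (t - t₀)) +
        (f (x t) - fstar) * (Real.exp (2 * μ * (t - t₀)) * (2 * μ * 1))) t := by
    intro t ht
    exact ((hd t ht).sub_const fstar).mul
      ((((hasDerivAt_id t).sub_const t₀).const_mul (2 * μ)).exp)
  intro t ht
  have key := hanti _ _ hd2 (fun s hs => by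
    have h1 := hPL (x s) (hle s hs)
    have h2 := Real.exp_pos (2 * μ * (s - t₀))
    nlinarith) t ht
  simp only [sub_self, mul_zero, Real.exp_zero, mul_one] at key
  have h3 : Real.exp (-2 * μ * (t - t₀)) = (Real.exp (2 * μ * (t - t₀)))⁻¹ := by
    rw [← Real.exp_neg]; ring_nf
  rw [h3, ← div_eq_mul_inv, le_div_iff₀ (Real.exp_pos _)]
  exact key
end

section
/- Let E be a complete real inner product space and f : E → ℝ a differentiable function whose gradient ∇f is Lipschitz continuous with constant R > 0, and suppose f is bounded below. If x : ℝ → E satisfies the gradient flow x'(t) = −∇f(x(t)) for all t ≥ 0, then ∇f(x(t)) → 0 as t → ∞. -/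
theorem decrease_aux (φ d : ℝ → ℝ) (a b c : ℝ) (hab : a ≤ b)
    (hd : ∀ t ∈ Set.Icc a b, HasDerivAt φ (d t) t) (hc : ∀ t ∈ Set.Icc a b, d t ≤ -c) :
    φ b ≤ φ a - c * (b - a) := by
  have h : AntitoneOn (fun t => φ t + c * t) (Set.Icc a b) := by
    have hD : ∀ t ∈ Set.Icc a b, HasDerivAt (fun t => φ t + c * t) (d t + c * 1) t :=
      fun t ht => (hd t ht).add ((hasDerivAt_id t).const_mul c)
    apply antitoneOn_of_hasDerivWithinAt_nonpos (f' := fun t => d t + c * 1) (convex_Icc a b)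
    · exact fun t ht => (hD t ht).continuousAt.continuousWithinAt
    · exact fun t ht => (hD t (interior_subset ht)).hasDerivWithinAt
    · intro t ht
      have := hc t (interior_subset ht)
      linarith
  have := h (Set.left_mem_Icc.2 hab) (Set.right_mem_Icc.2 hab) hab
  simp only at this
  linarith

/-- Gradient flow of a function that is bounded below and has an `R`-Lipschitz
gradient drives the gradient to zero: `∇f (x t) → 0` as `t → ∞`. -/
theorem gradient_flow_gradient_vanishes
    {E : Type*} [NormedAddCommGroup E] [InnerProductSpace ℝ E] [CompleteSpace E]
    (f : E → ℝ) (f' : E → E) (hf : ∀ y, HasGradientAt f (f' y) y)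
    (R : ℝ) (hR : 0 < R)
    (hLip : ∀ y₁ y₂, ‖f' y₁ - f' y₂‖ ≤ R * ‖y₁ - y₂‖)
    (hbdd : BddBelow (Set.range f))
    (x : ℝ → E)
    (hflow : ∀ t ≥ (0 : ℝ), HasDerivAt x (-f' (x t)) t) :
    Filter.Tendsto (fun t => f' (x t)) Filter.atTop (nhds 0) := by
  have hφ : ∀ t ≥ (0 : ℝ), HasDerivAt (fun t => f (x t)) (-‖f' (x t)‖ ^ 2) t := by
    intro t ht
    have := (hf (x t)).hasFDerivAt.comp_hasDerivAt t (hflow t ht)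
    simpa [Function.comp_def, inner_neg_right, real_inner_self_eq_norm_sq] using this
  obtain ⟨h, hh⟩ : ∃ h, h = Real.log (3 / 2) / R := ⟨_, rfl⟩
  have hpos : 0 < h := by rw [hh]; exact div_pos (Real.log_pos (by norm_num)) hR
  have hexp : Real.exp (R * h) = 3 / 2 := by
    rw [hh, mul_div_cancel₀ _ hR.ne', Real.exp_log (by norm_num)]
  have hgrow : ∀ t ≥ (0 : ℝ), ∀ s ∈ Set.Icc t (t + h), ‖f' (x t)‖ / 2 ≤ ‖f' (x s)‖ := by
    intro t ht s hs
    have key := norm_le_gronwallBound_of_norm_deriv_right_le (f := fun s => x s - x t)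
      (f' := fun s => -f' (x s)) (δ := 0) (K := R) (ε := ‖f' (x t)‖) (a := t) (b := t + h)
      (fun s hs => ((hflow s (ht.le.trans hs.1)).sub_const _).continuousAt.continuousWithinAt)
      (fun s hs => ((hflow s (ht.le.trans hs.1)).sub_const _).hasDerivWithinAt)
      (by simp)
      (by
        intro s hs
        have h1 := hLip (x s) (x t)
        have h2 := norm_le_norm_add_norm_sub' (f' (x s)) (f' (x t))
        rw [norm_neg]
        linarith) s hs
    rw [gronwallBound_of_K_ne_0 hR.ne'] at key
    have he : Real.exp (R * (s - t)) ≤ 3 / 2 := by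
      rw [← hexp]
      apply Real.exp_le_exp.2
      exact mul_le_mul_of_nonneg_left (by linarith [hs.2]) hR.le
    have h3 : R * ‖x s - x t‖ ≤ ‖f' (x t)‖ * (Real.exp (R * (s - t)) - 1) := by
      calc R * ‖x s - x t‖ ≤ R * _ := mul_le_mul_of_nonneg_left key hR.le
        _ = _ := by field_simp; ring
    have h1 := hLip (x s) (x t)
    have h2 := norm_le_norm_add_norm_sub (f' (x s)) (f' (x t))
    have h4 : ‖f' (x t)‖ * (Real.exp (R * (s - t)) - 1) ≤ ‖f' (x t)‖ * (1 / 2) :=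
      mul_le_mul_of_nonneg_left (by linarith) (norm_nonneg _)
    linarith
  have hdec : ∀ t ≥ (0 : ℝ), f (x (t + h)) ≤ f (x t) - (‖f' (x t)‖ / 2) ^ 2 * h := by
    intro t ht
    have := decrease_aux (fun t => f (x t)) (fun t => -‖f' (x t)‖ ^ 2) t (t + h)
      ((‖f' (x t)‖ / 2) ^ 2) (by linarith) (fun s hs => hφ s (ht.le.trans hs.1))
      (fun s hs => neg_le_neg (pow_le_pow_left₀ (by positivity) (hgrow t ht s hs) 2))
    simpa using this
  have hanti : Antitone (fun t : ℝ => f (x (max t 0))) := by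
    intro a b hab
    have := decrease_aux (fun t => f (x t)) (fun t => -‖f' (x t)‖ ^ 2) (max a 0) (max b 0) 0
      (max_le_max_right 0 hab) (fun s hs => hφ s ((le_max_right a 0).trans hs.1))
      (fun s hs => by simp)
    simpa using this
  have hlim := tendsto_atTop_ciInf hanti
    (hbdd.mono (by rintro _ ⟨t, rfl⟩; exact ⟨_, rfl⟩))
  have hlim2 := hlim.comp (Filter.tendsto_atTop_add_const_right Filter.atTop h Filter.tendsto_id)
  have hd := ((hlim.sub hlim2).mul_const (4 / h))
  rw [sub_self, zero_mul] at hd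
  have hsq : Filter.Tendsto (fun t => ‖f' (x t)‖ ^ 2) Filter.atTop (nhds 0) := by
    refine squeeze_zero' (Filter.Eventually.of_forall fun t => by positivity) ?_ hd
    filter_upwards [Filter.eventually_ge_atTop (0 : ℝ)] with t ht
    have := hdec t ht
    simp only [Function.comp, id]
    rw [max_eq_left ht, max_eq_left (by linarith : (0 : ℝ) ≤ t + h), mul_div_assoc',
      le_div_iff₀ hpos]
    linarith
  rw [tendsto_zero_iff_norm_tendsto_zero]
  have := hsq.sqrt
  simpa [Real.sqrt_sq (norm_nonneg _)] using this
end

section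
/- Let E be a complete real inner product space, f : E → ℝ differentiable with gradient ∇f, f* ∈ ℝ with f(y) ≥ f* for all y, and constants 0 < μ ≤ R. Suppose x : ℝ → E satisfies the gradient flow x'(t) = −∇f(x(t)) for all t ≥ t₀, and that for every y in the sublevel set {y : f(y) ≤ f(x(t₀))} both 2μ·(f(y) − f*) ≤ ‖∇f(y)‖² and ‖∇f(y)‖² ≤ 2R·(f(y) − f*) hold. Then for all t₀ ≤ t₂ ≤ t₁, ‖x(t₁) − x(t₂)‖ ≤ (√(2R·(f(x(t₀)) − f*))/μ)·(e^{−μ(t₂−t₀)} − e^{−μ(t₁−t₀)}). -/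
/-- Along a gradient flow satisfying the PL inequality (constant `μ`) and the
reverse PL inequality (constant `R`) on the initial sublevel set, the trajectory
satisfies the Cauchy-type bound
`‖x t₁ - x t₂‖ ≤ (√(2R (f (x t₀) - f*)) / μ) (e^{-μ(t₂-t₀)} - e^{-μ(t₁-t₀)})`. -/
theorem gradient_flow_trajectory_cauchy_bound
    {E : Type*} [NormedAddCommGroup E] [InnerProductSpace ℝ E] [CompleteSpace E]
    (f : E → ℝ) (f' : E → E) (hf : ∀ y, HasGradientAt f (f' y) y)
    (fstar : ℝ) (hbound : ∀ y, fstar ≤ f y)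
    (μ R : ℝ) (hμ : 0 < μ) (hμR : μ ≤ R)
    (t₀ : ℝ) (x : ℝ → E)
    (hflow : ∀ t ≥ t₀, HasDerivAt x (-f' (x t)) t)
    (hPL : ∀ y, f y ≤ f (x t₀) → 2 * μ * (f y - fstar) ≤ ‖f' y‖ ^ 2)
    (hRPL : ∀ y, f y ≤ f (x t₀) → ‖f' y‖ ^ 2 ≤ 2 * R * (f y - fstar)) :
    ∀ t₁ t₂, t₀ ≤ t₂ → t₂ ≤ t₁ →
      ‖x t₁ - x t₂‖ ≤ (Real.sqrt (2 * R * (f (x t₀) - fstar)) / μ) *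
        (Real.exp (-μ * (t₂ - t₀)) - Real.exp (-μ * (t₁ - t₀))) := by
  have hg : ∀ t ≥ t₀, HasDerivAt (fun s => f (x s)) (-‖f' (x t)‖ ^ 2) t := by
    intro t ht
    have h := (hf (x t)).hasFDerivAt.comp_hasDerivAt t (hflow t ht)
    have e : (InnerProductSpace.toDual ℝ E (f' (x t))) (-f' (x t)) = -‖f' (x t)‖ ^ 2 := by
      rw [InnerProductSpace.toDual_apply_apply, inner_neg_right, real_inner_self_eq_norm_sq]
    rw [← e]
    exact h
  have hanti : AntitoneOn (fun s => f (x s)) (Set.Ici t₀) := by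
    apply antitoneOn_of_deriv_nonpos (convex_Ici t₀)
    · exact fun t ht => (hg t ht).continuousAt.continuousWithinAt
    · exact fun t ht => (hg t (interior_subset ht)).differentiableAt.differentiableWithinAt
    · intro t ht
      rw [(hg t (interior_subset ht)).deriv]
      nlinarith [sq_nonneg ‖f' (x t)‖]
  have hsub : ∀ t ≥ t₀, f (x t) ≤ f (x t₀) := fun t ht =>
    hanti (Set.self_mem_Ici) ht ht
  have hex : ∀ t, HasDerivAt (fun s => Real.exp (-μ * (s - t₀)))
      (Real.exp (-μ * (t - t₀)) * (-μ)) t := by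
    intro t
    have h : HasDerivAt (fun s => -μ * (s - t₀)) (-μ) t := by
      simpa using ((hasDerivAt_id t).sub_const t₀).const_mul (-μ)
    exact h.exp
  have hex2 : ∀ t, HasDerivAt (fun s => Real.exp (2 * μ * (s - t₀)))
      (Real.exp (2 * μ * (t - t₀)) * (2 * μ)) t := by
    intro t
    have h : HasDerivAt (fun s => 2 * μ * (s - t₀)) (2 * μ) t := by
      simpa using ((hasDerivAt_id t).sub_const t₀).const_mul (2 * μ)
    exact h.exp
  have hh : ∀ t ≥ t₀, HasDerivAt (fun s => Real.exp (2 * μ * (s - t₀)) * (f (x s) - fstar))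
      (Real.exp (2 * μ * (t - t₀)) * (2 * μ) * (f (x t) - fstar)
        + Real.exp (2 * μ * (t - t₀)) * (-‖f' (x t)‖ ^ 2)) t :=
    fun t ht => (hex2 t).mul ((hg t ht).sub_const fstar)
  have hanti2 : AntitoneOn (fun s => Real.exp (2 * μ * (s - t₀)) * (f (x s) - fstar))
      (Set.Ici t₀) := by
    apply antitoneOn_of_deriv_nonpos (convex_Ici t₀)
    · exact fun t ht => (hh t ht).continuousAt.continuousWithinAt
    · exact fun t ht => (hh t (interior_subset ht)).differentiableAt.differentiableWithinAt
    · intro t ht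
      have ht' : t ≥ t₀ := interior_subset ht
      rw [(hh t ht').deriv]
      have := hPL (x t) (hsub t ht')
      nlinarith [Real.exp_pos (2 * μ * (t - t₀))]
  have hnorm : ∀ t ≥ t₀, ‖f' (x t)‖ ≤
      Real.sqrt (2 * R * (f (x t₀) - fstar)) * Real.exp (-μ * (t - t₀)) := by
    intro t ht
    have h1 := hanti2 (Set.self_mem_Ici) (show t ∈ Set.Ici t₀ from ht) ht
    simp only [sub_self, mul_zero, Real.exp_zero, one_mul] at h1
    have h2 := hRPL (x t) (hsub t ht)
    have h3 : Real.exp (-μ * (t - t₀)) ^ 2 * Real.exp (2 * μ * (t - t₀)) = 1 := by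
      rw [← Real.exp_nat_mul, ← Real.exp_add, ← Real.exp_zero]
      congr 1
      push_cast
      ring
    have hR : 0 < R := hμ.trans_le hμR
    have h0 : 0 ≤ 2 * R * (f (x t₀) - fstar) :=
      mul_nonneg (by positivity) (sub_nonneg.2 (hbound _))
    refine (sq_le_sq₀ (norm_nonneg _) (by positivity)).1 ?_
    rw [mul_pow, Real.sq_sqrt h0]
    have h4 : f (x t) - fstar ≤ Real.exp (-μ * (t - t₀)) ^ 2 * (f (x t₀) - fstar) := by
      have := mul_le_mul_of_nonneg_left h1 (sq_nonneg (Real.exp (-μ * (t - t₀))))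
      rwa [← mul_assoc, h3, one_mul] at this
    calc _ ≤ _ := h2
      _ ≤ 2 * R * (Real.exp (-μ * (t - t₀)) ^ 2 * (f (x t₀) - fstar)) := by gcongr
      _ = _ := by ring
  intro t₁ t₂ h02 h21
  set C := Real.sqrt (2 * R * (f (x t₀) - fstar)) with hC
  refine image_norm_le_of_norm_deriv_right_le_deriv_boundary (a := t₂) (b := t₁)
    (f := fun t => x t - x t₂) (f' := fun t => -f' (x t))
    (B := fun t => C / μ * (Real.exp (-μ * (t₂ - t₀)) - Real.exp (-μ * (t - t₀))))
    (B' := fun t => C * Real.exp (-μ * (t - t₀))) ?_ ?_ ?_ ?_ ?_ (Set.right_mem_Icc.2 h21)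
  · exact fun t ht =>
      ((hflow t (h02.trans ht.1)).sub_const _).continuousAt.continuousWithinAt
  · exact fun t ht => ((hflow t (h02.trans ht.1)).sub_const _).hasDerivWithinAt
  · simp
  · intro t
    have h := ((hex t).const_sub (Real.exp (-μ * (t₂ - t₀)))).const_mul (C / μ)
    have e : C / μ * -(Real.exp (-μ * (t - t₀)) * -μ) = C * Real.exp (-μ * (t - t₀)) := by
      have := hμ.ne'
      generalize Real.exp (-μ * (t - t₀)) = z
      field_simp
    rw [e] at h
    exact h
  · intro t ht
    rw [norm_neg]
    exact hnorm t (h02.trans ht.1)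
end

section
/- Let E be a complete real inner product space, f : E → ℝ continuous and differentiable with gradient ∇f, f* ∈ ℝ with f(y) ≥ f* for all y, and constants 0 < μ ≤ R. Suppose x : ℝ → E satisfies the gradient flow x'(t) = −∇f(x(t)) for all t ≥ t₀, and that for every y in the sublevel set {y : f(y) ≤ f(x(t₀))} both 2μ·(f(y) − f*) ≤ ‖∇f(y)‖² and ‖∇f(y)‖² ≤ 2R·(f(y) − f*) hold. Then there exists x̄ ∈ E such that x(t) → x̄ as t → ∞, f(x̄) = f*, and for all t ≥ t₀, ‖x(t) − x̄‖ ≤ (√(2R·(f(x(t₀)) − f*))/μ)·e^{−μ(t−t₀)}. -/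
/-- Along a gradient flow satisfying the PL inequality (constant `μ`) and the
reverse PL inequality (constant `R`) on the initial sublevel set, the trajectory
converges exponentially to a limit `x̄` with `f x̄ = f*`:
`‖x t - x̄‖ ≤ (√(2R (f (x t₀) - f*)) / μ) e^{-μ (t - t₀)}`. -/
theorem gradient_flow_exponential_convergence_to_minimizer
    {E : Type*} [NormedAddCommGroup E] [InnerProductSpace ℝ E] [CompleteSpace E]
    (f : E → ℝ) (hcont : Continuous f)
    (f' : E → E) (hf : ∀ y, HasGradientAt f (f' y) y)
    (fstar : ℝ) (hbound : ∀ y, fstar ≤ f y)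
    (μ R : ℝ) (hμ : 0 < μ) (hμR : μ ≤ R)
    (t₀ : ℝ) (x : ℝ → E)
    (hflow : ∀ t ≥ t₀, HasDerivAt x (-f' (x t)) t)
    (hPL : ∀ y, f y ≤ f (x t₀) → 2 * μ * (f y - fstar) ≤ ‖f' y‖ ^ 2)
    (hRPL : ∀ y, f y ≤ f (x t₀) → ‖f' y‖ ^ 2 ≤ 2 * R * (f y - fstar)) :
    ∃ xbar : E, Filter.Tendsto x Filter.atTop (nhds xbar) ∧ f xbar = fstar ∧
      ∀ t ≥ t₀, ‖x t - xbar‖ ≤ (Real.sqrt (2 * R * (f (x t₀) - fstar)) / μ) *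
        Real.exp (-μ * (t - t₀)) := by
  have hφ : ∀ t ≥ t₀, HasDerivAt (fun t => f (x t)) (-‖f' (x t)‖ ^ 2) t := by
    intro t ht
    have h := (hf (x t)).hasFDerivAt.comp_hasDerivAt t (hflow t ht)
    simpa [Function.comp_def, inner_neg_right, real_inner_self_eq_norm_sq] using h
  have hx0 : ∀ t ≥ t₀, f (x t) ≤ f (x t₀) := by
    have : AntitoneOn (fun t => f (x t)) (Set.Ici t₀) := by
      refine antitoneOn_of_hasDerivWithinAt_nonpos (f' := fun t => -‖f' (x t)‖ ^ 2)
        (convex_Ici t₀)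
        (fun t ht => (hφ t ht).continuousAt.continuousWithinAt) ?_ ?_
      · intro t ht
        exact (hφ t (interior_subset ht)).hasDerivWithinAt
      · intro t ht
        have := sq_nonneg ‖f' (x t)‖
        linarith
    intro t ht
    exact this (Set.mem_Ici.2 le_rfl) ht ht
  have hE : ∀ c t : ℝ, HasDerivAt (fun t => Real.exp (c * (t - t₀)))
      (Real.exp (c * (t - t₀)) * c) t := by
    intro c t
    have h := ((((hasDerivAt_id t).sub_const t₀).const_mul c)).exp
    simpa using h
  have hdecay : ∀ t ≥ t₀, f (x t) - fstar ≤
      (f (x t₀) - fstar) * Real.exp (-μ * (t - t₀)) ^ 2 := by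
    have hd : ∀ t ≥ t₀, HasDerivAt
        (fun t => (f (x t) - fstar) * Real.exp ((2 * μ) * (t - t₀)))
        (-‖f' (x t)‖ ^ 2 * Real.exp ((2 * μ) * (t - t₀)) +
          (f (x t) - fstar) * (Real.exp ((2 * μ) * (t - t₀)) * (2 * μ))) t := by
      intro t ht
      exact ((hφ t ht).sub_const fstar).mul (hE (2 * μ) t)
    have : AntitoneOn (fun t => (f (x t) - fstar) * Real.exp ((2 * μ) * (t - t₀)))
        (Set.Ici t₀) := by
      refine antitoneOn_of_hasDerivWithinAt_nonpos (convex_Ici t₀)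
        (fun t ht => (hd t ht).continuousAt.continuousWithinAt)
        (fun t ht => (hd t (interior_subset ht)).hasDerivWithinAt) ?_
      intro t ht
      have h1 := hPL (x t) (hx0 t (interior_subset ht))
      have h2 := Real.exp_pos ((2 * μ) * (t - t₀))
      nlinarith
    intro t ht
    have h := this (Set.mem_Ici.2 le_rfl) ht ht
    simp only [sub_self, mul_zero, Real.exp_zero, mul_one] at h
    have he : Real.exp ((2 * μ) * (t - t₀)) * Real.exp (-μ * (t - t₀)) ^ 2 = 1 := by
      rw [← Real.exp_nat_mul, ← Real.exp_add, Real.exp_eq_one_iff]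
      push_cast
      ring
    have h3 := mul_le_mul_of_nonneg_right h (sq_nonneg (Real.exp (-μ * (t - t₀))))
    rwa [mul_assoc, he, mul_one] at h3
  set C := Real.sqrt (2 * R * (f (x t₀) - fstar)) with hC
  have hR : 0 < R := hμ.trans_le hμR
  have hC0 : 0 ≤ C := Real.sqrt_nonneg _
  have hnorm : ∀ t ≥ t₀, ‖f' (x t)‖ ≤ C * Real.exp (-μ * (t - t₀)) := by
    intro t ht
    have h0 : 0 ≤ 2 * R * (f (x t₀) - fstar) :=
      mul_nonneg (by linarith) (sub_nonneg.2 (hbound _))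
    refine (sq_le_sq₀ (norm_nonneg _) (by positivity)).1 ?_
    rw [mul_pow, hC, Real.sq_sqrt h0]
    have h1 := hRPL _ (hx0 t ht)
    have h2 := mul_le_mul_of_nonneg_left (hdecay t ht) (by linarith : 0 ≤ 2 * R)
    linarith
  have hdist : ∀ s ≥ t₀, ∀ t ≥ s, ‖x t - x s‖ ≤ C / μ * Real.exp (-μ * (s - t₀)) := by
    intro s hs t ht
    have key := image_norm_le_of_norm_deriv_right_le_deriv_boundary
      (f := fun u => x u - x s) (f' := fun u => -f' (x u)) (a := s) (b := t)
      (B := fun u => C / μ * Real.exp (-μ * (s - t₀)) - C / μ * Real.exp (-μ * (u - t₀)))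
      (B' := fun u => C * Real.exp (-μ * (u - t₀)))
      (fun u hu => ((hflow u (hs.le.trans hu.1)).sub_const (x s)).continuousAt.continuousWithinAt)
      (fun u hu => ((hflow u (hs.le.trans hu.1)).sub_const (x s)).hasDerivWithinAt)
      (by simp)
      (fun u => by
        have h := ((hE (-μ) u).const_mul (C / μ)).const_sub (C / μ * Real.exp (-μ * (s - t₀)))
        have e : C * Real.exp (-μ * (u - t₀)) =
            -(C / μ * (Real.exp (-μ * (u - t₀)) * -μ)) := by
          have := hμ.ne'
          field_simp
        rw [e]
        exact h)
      (fun u hu => by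
        rw [norm_neg]
        exact hnorm u (hs.le.trans hu.1))
      (Set.right_mem_Icc.2 ht)
    have : 0 ≤ C / μ * Real.exp (-μ * (t - t₀)) := by positivity
    linarith
  have hexp : Filter.Tendsto (fun t => Real.exp (-μ * (t - t₀))) Filter.atTop (nhds 0) := by
    apply Real.tendsto_exp_atBot.comp
    apply Filter.Tendsto.const_mul_atTop_of_neg (by linarith)
    exact Filter.tendsto_atTop_add_const_right _ (-t₀) Filter.tendsto_id
  have hcau : CauchySeq x := by
    apply Metric.cauchySeq_iff'.2
    intro ε hε
    have h1 : Filter.Tendsto (fun t => C / μ * Real.exp (-μ * (t - t₀))) Filter.atTop (nhds 0) := by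
      simpa using hexp.const_mul (C / μ)
    obtain ⟨N, hN, hN'⟩ := ((h1.eventually (gt_mem_nhds hε)).and
      (Filter.eventually_ge_atTop t₀)).exists
    refine ⟨N, fun n hn => ?_⟩
    rw [dist_eq_norm]
    exact (hdist N hN' n hn).trans_lt hN
  obtain ⟨xbar, hxbar⟩ := cauchySeq_tendsto_of_complete hcau
  refine ⟨xbar, hxbar, ?_, ?_⟩
  · have h1 : Filter.Tendsto (fun t => f (x t) - fstar) Filter.atTop (nhds (f xbar - fstar)) :=
      ((hcont.tendsto xbar).comp hxbar).sub_const fstar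
    have h2 : Filter.Tendsto (fun t => (f (x t₀) - fstar) * Real.exp (-μ * (t - t₀)) ^ 2)
        Filter.atTop (nhds 0) := by
      simpa using (hexp.pow 2).const_mul (f (x t₀) - fstar)
    have h3 := le_of_tendsto_of_tendsto h1 h2
      ((Filter.eventually_ge_atTop t₀).mono hdecay)
    linarith [hbound xbar]
  · intro t ht
    have h1 : Filter.Tendsto (fun u => ‖x t - x u‖) Filter.atTop (nhds ‖x t - xbar‖) :=
      (hxbar.const_sub (x t)).norm
    refine le_of_tendsto h1 ((Filter.eventually_ge_atTop t).mono fun u hu => ?_)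
    rw [norm_sub_rev]
    exact hdist t ht u hu
end

section
/- Let A, S, Π be real n×n matrices with S symmetric positive semidefinite and Π symmetric positive definite, satisfying the Lyapunov equation A·S + S·Aᵀ + Π = 0. Then 2·‖A‖_F·λ_min(S) ≥ λ_min(Π), where ‖A‖_F is the Frobenius norm of A and λ_min denotes the smallest eigenvalue of a symmetric matrix. In particular λ_min(S) ≥ λ_min(Π)/(2‖A‖_F). -/
open Matrix

attribute [local instance] Matrix.frobeniusNormedAddCommGroup

theorem aux_frob {n : ℕ} (A : Matrix (Fin n) (Fin n) ℝ) (v : Fin n → ℝ) (hv : v ⬝ᵥ v = 1) :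
    |v ⬝ᵥ (A *ᵥ v)| ≤ ‖A‖ := by
  have h1 : ‖A‖ ^ 2 = ∑ p : Fin n × Fin n, A p.1 p.2 ^ 2 := by
    rw [Matrix.frobenius_norm_def, ← Real.sqrt_eq_rpow, Real.sq_sqrt, Fintype.sum_prod_type]
    · simp
    · positivity
  have h2 : v ⬝ᵥ (A *ᵥ v) = ∑ p : Fin n × Fin n, (v p.1 * v p.2) * A p.1 p.2 := by
    rw [Fintype.sum_prod_type]
    simp only [dotProduct, mulVec, Finset.mul_sum]
    refine Finset.sum_congr rfl fun i _ => Finset.sum_congr rfl fun j _ => by ring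
  have h3 : ∑ p : Fin n × Fin n, (v p.1 * v p.2) ^ 2 = 1 := by
    rw [Fintype.sum_prod_type]
    have : (v ⬝ᵥ v) * (v ⬝ᵥ v) = 1 := by rw [hv]; ring
    rw [← this]
    simp only [dotProduct, Finset.sum_mul_sum]
    refine Finset.sum_congr rfl fun i _ => Finset.sum_congr rfl fun j _ => by ring
  refine abs_le_of_sq_le_sq ?_ (norm_nonneg A)
  have := Finset.sum_mul_sq_le_sq_mul_sq Finset.univ
    (fun p : Fin n × Fin n => v p.1 * v p.2) (fun p => A p.1 p.2)
  rw [h1, h2]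
  rw [h3, one_mul] at this
  exact this

theorem aux_rayleigh {n : ℕ} (P : Matrix (Fin n) (Fin n) ℝ) (hP : P.IsHermitian)
    (v : Fin n → ℝ) (hv : v ⬝ᵥ v = 1) :
    (⨅ i, hP.eigenvalues i) ≤ v ⬝ᵥ (P *ᵥ v) := by
  have key : ∀ x y : Fin n → ℝ, ∑ i, (x ⬝ᵥ ⇑(hP.eigenvectorBasis i)) *
      (⇑(hP.eigenvectorBasis i) ⬝ᵥ y) = x ⬝ᵥ y := by
    intro x y
    have := hP.eigenvectorBasis.sum_inner_mul_inner (WithLp.toLp 2 x) (WithLp.toLp 2 y)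
    simp only [EuclideanSpace.inner_eq_star_dotProduct, star_trivial] at this
    rw [dotProduct_comm x y, ← this]
    refine Finset.sum_congr rfl fun i _ => ?_
    rw [dotProduct_comm x, dotProduct_comm _ y]
  have hT : Pᵀ = P := by rw [← conjTranspose_eq_transpose_of_trivial]; exact hP
  have h2 : ∀ i, ⇑(hP.eigenvectorBasis i) ⬝ᵥ (P *ᵥ v) =
      hP.eigenvalues i * (v ⬝ᵥ ⇑(hP.eigenvectorBasis i)) := by
    intro i
    rw [dotProduct_mulVec, ← mulVec_transpose, hT, hP.mulVec_eigenvectorBasis, smul_dotProduct,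
      smul_eq_mul, dotProduct_comm]
  rw [← key v (P *ᵥ v)]
  calc (⨅ i, hP.eigenvalues i) = (⨅ i, hP.eigenvalues i) * (v ⬝ᵥ v) := by rw [hv, mul_one]
    _ ≤ _ := by
      rw [← key v v, Finset.mul_sum]
      refine Finset.sum_le_sum fun i _ => ?_
      rw [h2, dotProduct_comm _ v]
      have := ciInf_le (Set.finite_range hP.eigenvalues).bddBelow i
      nlinarith [mul_self_nonneg (v ⬝ᵥ ⇑(hP.eigenvectorBasis i))]

/-- For the Lyapunov equation `A S + S Aᵀ + Π = 0` with `S ⪰ 0` and `Π ≻ 0`,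
one has `2 ‖A‖_F λ_min(S) ≥ λ_min(Π)`; in particular
`λ_min(S) ≥ λ_min(Π) / (2 ‖A‖_F)`. -/
theorem lyapunov_min_eigenvalue_bound {n : ℕ}
    (A S P : Matrix (Fin n) (Fin n) ℝ)
    (hS : S.PosSemidef) (hP : P.PosDef)
    (hlyap : A * S + S * Aᵀ + P = 0) :
    (⨅ i, hP.1.eigenvalues i) ≤ 2 * ‖A‖ * (⨅ i, hS.1.eigenvalues i) ∧
    (⨅ i, hP.1.eigenvalues i) / (2 * ‖A‖) ≤ (⨅ i, hS.1.eigenvalues i) := by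
  have h0 : 0 ≤ ⨅ i, hS.1.eigenvalues i := Real.iInf_nonneg fun i => hS.eigenvalues_nonneg i
  have hmain : (⨅ i, hP.1.eigenvalues i) ≤ 2 * ‖A‖ * (⨅ i, hS.1.eigenvalues i) := by
    rcases isEmpty_or_nonempty (Fin n) with hn | hn
    · simp [Real.iInf_of_isEmpty]
    obtain ⟨k, hk⟩ := exists_eq_ciInf_of_finite (f := hS.1.eigenvalues)
    rw [← hk] at h0 ⊢
    have hSv := hS.1.mulVec_eigenvectorBasis k
    have hv : (⇑(hS.1.eigenvectorBasis k) : Fin n → ℝ) ⬝ᵥ ⇑(hS.1.eigenvectorBasis k) = 1 := by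
      have := hS.1.eigenvectorBasis.orthonormal.1 k
      have h := real_inner_self_eq_norm_sq (hS.1.eigenvectorBasis k)
      rw [this, EuclideanSpace.inner_eq_star_dotProduct, star_trivial] at h
      simpa using h
    generalize (⇑(hS.1.eigenvectorBasis k) : Fin n → ℝ) = v at hSv hv
    generalize hS.1.eigenvalues k = l at *
    have hT : Sᵀ = S := by rw [← conjTranspose_eq_transpose_of_trivial]; exact hS.1
    have hr := aux_rayleigh P hP.1 v hv
    have hf := (abs_le.mp (aux_frob A v hv)).1
    have e : v ⬝ᵥ ((A * S + S * Aᵀ + P) *ᵥ v) = 0 := by rw [hlyap]; simp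
    have e2 : v ⬝ᵥ ((S * Aᵀ) *ᵥ v) = l * (v ⬝ᵥ (A *ᵥ v)) := by
      rw [← mulVec_mulVec, dotProduct_mulVec, ← mulVec_transpose, hT, hSv, smul_dotProduct,
        smul_eq_mul, mulVec_transpose, dotProduct_comm, ← dotProduct_mulVec]
    rw [add_mulVec, add_mulVec, dotProduct_add, dotProduct_add, e2, ← mulVec_mulVec, hSv,
      mulVec_smul, dotProduct_smul, smul_eq_mul] at e
    nlinarith
  refine ⟨hmain, ?_⟩
  rcases (norm_nonneg A).eq_or_lt with h | h
  · rw [← h]; simpa using h0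
  · rw [div_le_iff₀ (by positivity)]; linarith
end
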